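/- Let K = ℚ(ξ) where ξ is a root of f₁₂(x) = x¹² + 8x⁸ + 15x⁴ + 7, let μ = −ξ⁴, and let M = ℚ(μ). If ζ ∈ O_K satisfies ℤ[ζ] = O_K (that is, ζ generates a power integral basis of K), then there exist rational integers z₀, z₁, z₂ and a unit ε of O_M such that ζ = z₀ + z₁μ + z₂μ² + ε·ξ. -/

import Mathlib

open NumberField

section

open Polynomial

section General

variable {R S : Type*} [CommRing R] [IsDomain R] [IsIntegrallyClosed R]
  [CommRing S] [IsDomain S] [Algebra R S] [Module.IsTorsionFree R S]

theorem minpoly_eq_of_isEisensteinAt {p : R} (hp : Prime p) {f : R[X]} (hf : f.Monic)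
    (hd : 0 < f.natDegree) (he : f.IsEisensteinAt (Ideal.span {p})) {x : S}
    (hx : aeval x f = 0) : minpoly R x = f := by
  have hint : IsIntegral R x := ⟨f, hf, by rwa [← aeval_def]⟩
  have hirr := he.irreducible ((Ideal.span_singleton_prime hp.ne_zero).2 hp) hf.isPrimitive hd
  have hdvd := minpoly.isIntegrallyClosed_dvd hint hx
  refine eq_of_monic_of_associated (minpoly.monic hint) hf ?_
  exact (minpoly.prime_of_isIntegrallyClosed hint).irreducible.associated_of_dvd hirr hdvd

omit [IsDomain R] [IsIntegrallyClosed R] in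
theorem isEisensteinAt_of_monic_of_dvd {p : R} (hp : Prime p) {f : R[X]} (hf : f.Monic)
    (hdvd : ∀ n < f.natDegree, p ∣ f.coeff n) (h0 : ¬ p ^ 2 ∣ f.coeff 0) :
    f.IsEisensteinAt (Ideal.span {p}) where
  leading := by
    rw [hf.leadingCoeff, Ideal.mem_span_singleton]
    exact fun h => hp.not_isUnit (isUnit_of_dvd_one h)
  mem {n} hn := Ideal.mem_span_singleton.2 (hdvd n hn)
  notMem := by rwa [Ideal.span_singleton_pow, Ideal.mem_span_singleton]

end General

theorem adjoin_sub_algebraMap {R S : Type*} [CommRing R] [CommRing S] [Algebra R S] (x : S)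
    (c : R) :
    Algebra.adjoin R {x - algebraMap R S c} = Algebra.adjoin R {x} := by
  apply le_antisymm <;> apply Algebra.adjoin_le <;>
    refine Set.singleton_subset_iff.2 ?_
  · exact sub_mem (Algebra.self_mem_adjoin_singleton R x) (Subalgebra.algebraMap_mem _ c)
  · simpa using add_mem (Algebra.self_mem_adjoin_singleton R (x - algebraMap R S c))
      (Subalgebra.algebraMap_mem _ c)

theorem exists_eq_sum_of_mem_adjoin {R S : Type*} [CommRing R] [Nontrivial R] [CommRing S]
    [Algebra R S] {f : R[X]} (hf : f.Monic) {x y : S} (hx : aeval x f = 0)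
    (hy : y ∈ Algebra.adjoin R {x}) {n : ℕ} (hn : f.natDegree = n) :
    ∃ c : Fin n → R, y = ∑ i, algebraMap R S (c i) * x ^ (i : ℕ) := by
  subst hn
  rw [Algebra.adjoin_singleton_eq_range_aeval] at hy
  obtain ⟨q, rfl⟩ := hy
  refine ⟨fun i => (q %ₘ f).coeff i, ?_⟩
  have h : aeval x (q %ₘ f) = aeval x q := by
    conv_rhs => rw [← modByMonic_add_div q f]
    simp [hx]
  by_cases h1 : f = 1
  · subst h1
    have := subsingleton_of_zero_eq_one (show (0 : S) = 1 by simpa using hx.symm)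
    exact Subsingleton.elim _ _
  · change aeval x q = _
    rw [← h, aeval_eq_sum_range' (natDegree_modByMonic_lt q hf h1),
      Fin.sum_univ_eq_sum_range (fun i => algebraMap R S ((q %ₘ f).coeff i) * x ^ i)]
    simp [Algebra.smul_def]

section AKLB

variable {A F B : Type*} {L : Type*} [CommRing A] [IsDedekindDomain A] [Field F] [Algebra A F]
  [IsFractionRing A F] [Field L] [Algebra F L] [FiniteDimensional F L] [Algebra.IsSeparable F L]
  [CommRing B] [IsDedekindDomain B] [Algebra A B] [Algebra B L] [Algebra A L]
  [IsScalarTower A F L] [IsScalarTower A B L] [IsIntegralClosure B A L]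
  [Module.IsTorsionFree A B]

variable (F L) in
theorem aeval_derivative_minpoly_mul_mem_adjoin {x : B}
    (hx : Algebra.adjoin F {algebraMap B L x} = ⊤) (y : B) :
    aeval x (derivative (minpoly A x)) * y ∈ Algebra.adjoin A {x} := by
  have h := conductor_mul_differentIdeal A F L x hx
  have hmem : aeval x (derivative (minpoly A x)) ∈ conductor A x := by
    apply Ideal.mul_le_left (I := conductor A x) (J := differentIdeal A B)
    rw [h]; exact Ideal.mem_span_singleton_self _
  exact mem_conductor_iff.1 hmem y

omit [FiniteDimensional F L] [Algebra.IsSeparable F L] [IsDedekindDomain B]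
  [Module.IsTorsionFree A B] in
variable (F L) in
theorem mem_adjoin_of_prime_pow_mul_mem {p : A} (hp : Prime p) {x : B}
    (hx : Algebra.adjoin F {algebraMap B L x} = ⊤)
    (he : (minpoly A x).IsEisensteinAt (Ideal.span {p})) {n : ℕ} {z : B}
    (hz : algebraMap A B p ^ n * z ∈ Algebra.adjoin A {x}) : z ∈ Algebra.adjoin A {x} := by
  have hinj : Function.Injective (algebraMap B L) := IsIntegralClosure.algebraMap_injective B A L
  have hmap : Algebra.adjoin A {algebraMap B L x} =
      (Algebra.adjoin A {x}).map (IsScalarTower.toAlgHom A B L) := by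
    rw [AlgHom.map_adjoin_singleton]; rfl
  have hxA : IsIntegral A (algebraMap B L x) := IsIntegralClosure.isIntegral_iff (A := B).2 ⟨x, rfl⟩
  let P := PowerBasis.ofAdjoinEqTop (hxA.tower_top (A := F)) hx
  have hgen : P.gen = algebraMap B L x := by simp [P]
  have key := mem_adjoin_of_smul_prime_pow_smul_of_minpoly_isEisensteinAt (B := P) hp
    (by rwa [hgen]) (n := n) (z := algebraMap B L z)
    (IsIntegralClosure.isIntegral_iff (A := B).2 ⟨z, rfl⟩)
    (by
      rw [hgen, hmap]
      refine ⟨_, hz, ?_⟩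
      simp [Algebra.smul_def, ← IsScalarTower.algebraMap_apply])
    (by rwa [hgen, minpoly.algebraMap_eq hinj])
  rw [hgen, hmap] at key
  obtain ⟨w, hw, hwz⟩ := key
  rwa [← hinj hwz]

end AKLB

theorem exists_basis_pow_of_adjoin_eq_top {R S : Type*} [CommRing R] [IsDomain R]
    [IsIntegrallyClosed R] [CommRing S] [IsDomain S] [Algebra R S] [Module.IsTorsionFree R S]
    {x : S} (hx : IsIntegral R x) (htop : Algebra.adjoin R {x} = ⊤) {n : ℕ}
    (hn : Module.finrank R S = n) : ∃ e : Module.Basis (Fin n) R S, ∀ i, e i = x ^ (i : ℕ) := by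
  obtain ⟨P, rfl⟩ : ∃ P : PowerBasis R S, P.gen = x :=
    ⟨PowerBasis.ofAdjoinEqTop' hx htop, PowerBasis.ofAdjoinEqTop'_gen hx htop⟩
  exact ⟨P.basis.reindex (finCongr (P.finrank.symm.trans hn)), fun i => by simp⟩

theorem adjoin_eq_top_of_tower {R : Type*} (A : Type*) {B : Type*} [CommSemiring R]
    [CommSemiring A] [Semiring B] [Algebra R A] [Algebra R B] [Algebra A B] [IsScalarTower R A B]
    {s : Set B} (h : Algebra.adjoin R s = ⊤) : Algebra.adjoin A s = ⊤ := by
  have hle : Algebra.adjoin R s ≤ (Algebra.adjoin A s).restrictScalars R :=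
    Algebra.adjoin_le Algebra.subset_adjoin
  exact top_unique fun y _ => hle (h ▸ Algebra.mem_top)

theorem isIntegral_int_of_cubic {R : Type*} [CommRing R] {a : R}
    (ha : a ^ 3 - 8 * a ^ 2 + 15 * a - 7 = 0) : IsIntegral ℤ a :=
  ⟨X ^ 3 - C 8 * X ^ 2 + C 15 * X - C 7, by monicity!, by simpa using ha⟩

section CubicField

variable {M : Type*} [Field M] [NumberField M] {m : 𝓞 M}

theorem minpoly_sub_nine (hm : m ^ 3 - 8 * m ^ 2 + 15 * m - 7 = 0) :
    minpoly ℤ (m - 9) = X ^ 3 + 19 * X ^ 2 + 114 * X + 209 ∧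
      (minpoly ℤ (m - 9)).IsEisensteinAt (Ideal.span {19}) := by
  have hp : Prime (19 : ℤ) := by norm_num
  have hf : (X ^ 3 + 19 * X ^ 2 + 114 * X + 209 : ℤ[X]).Monic := by monicity!
  have hd : (X ^ 3 + 19 * X ^ 2 + 114 * X + 209 : ℤ[X]).natDegree = 3 := by compute_degree!
  have hei : (X ^ 3 + 19 * X ^ 2 + 114 * X + 209 : ℤ[X]).IsEisensteinAt (Ideal.span {19}) := by
    refine isEisensteinAt_of_monic_of_dvd hp hf (fun n hn => ?_) ?_
    · rw [hd] at hn
      interval_cases n <;> simp [coeff_X, coeff_ofNat_mul, coeff_X_pow]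
    · simp [coeff_ofNat_mul]
  have h := minpoly_eq_of_isEisensteinAt hp hf (by rw [hd]; norm_num) hei (x := m - 9)
    (by simp only [map_add, map_mul, map_pow, aeval_X, map_ofNat]; linear_combination hm)
  exact ⟨h, h ▸ hei⟩

theorem adjoin_int_eq_top (hm : m ^ 3 - 8 * m ^ 2 + 15 * m - 7 = 0)
    (hgen : Algebra.adjoin ℚ {(m : M)} = ⊤) : Algebra.adjoin ℤ {m - 9} = ⊤ := by
  obtain ⟨h, hei⟩ := minpoly_sub_nine hm
  have hx : Algebra.adjoin ℚ {algebraMap (𝓞 M) M (m - 9)} = ⊤ := by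
    have := adjoin_sub_algebraMap (R := ℚ) (m : M) 9
    rw [hgen] at this
    rw [map_sub, map_ofNat]
    simpa using this
  refine Algebra.eq_top_iff.2 fun y => ?_
  refine mem_adjoin_of_prime_pow_mul_mem ℚ M (p := (19 : ℤ)) (n := 1) (by norm_num) hx hei ?_
  have hy := aeval_derivative_minpoly_mul_mem_adjoin ℚ M (A := ℤ) hx y
  have hθ := Algebra.self_mem_adjoin_singleton ℤ (m - 9)
  have key : algebraMap ℤ (𝓞 M) 19 ^ 1 * y =
      (57 + 23 * (m - 9) + 2 * (m - 9) ^ 2) *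
        (aeval (m - 9) (derivative (minpoly ℤ (m - 9))) * y) := by
    rw [h]
    simp only [derivative_add, derivative_mul, derivative_X_pow, derivative_ofNat, derivative_X]
    simp only [map_add, map_mul, map_pow, aeval_X, map_ofNat, map_zero, map_one, Nat.cast_ofNat]
    simp
    linear_combination (-(6 * m - 23) * y) * hm
  rw [key]
  refine mul_mem (add_mem (add_mem ?_ (mul_mem ?_ hθ)) (mul_mem ?_ (pow_mem hθ 2))) hy <;>
    exact ofNat_mem _ _

theorem exists_int_coords (hm : m ^ 3 - 8 * m ^ 2 + 15 * m - 7 = 0)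
    (hgen : Algebra.adjoin ℚ {(m : M)} = ⊤) (x : 𝓞 M) :
    ∃ a b c : ℤ, x = a + b * m + c * m ^ 2 := by
  have hf : (X ^ 3 - 8 * X ^ 2 + 15 * X - 7 : ℤ[X]).Monic := by monicity!
  have hd : (X ^ 3 - 8 * X ^ 2 + 15 * X - 7 : ℤ[X]).natDegree = 3 := by compute_degree!
  have hx : x ∈ Algebra.adjoin ℤ {m} := by
    have := adjoin_sub_algebraMap (R := ℤ) m 9
    rw [map_ofNat, adjoin_int_eq_top hm hgen] at this
    rw [← this]; trivial
  obtain ⟨c, hc⟩ := exists_eq_sum_of_mem_adjoin hf (by simpa [map_ofNat] using hm) hx rfl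
  rw [← (finCongr hd.symm).sum_comp] at hc
  exact ⟨_, _, _, by simpa [Fin.sum_univ_three] using hc⟩

theorem int_coords_eq_zero (hm : m ^ 3 - 8 * m ^ 2 + 15 * m - 7 = 0) {a b c : ℤ}
    (h : (a + b * m + c * m ^ 2 : 𝓞 M) = 0) : a = 0 ∧ b = 0 ∧ c = 0 := by
  obtain ⟨hmin, -⟩ := minpoly_sub_nine hm
  have hint : IsIntegral ℤ (m - 9) := RingOfIntegers.isIntegral _
  have hd : (X ^ 3 + 19 * X ^ 2 + 114 * X + 209 : ℤ[X]).natDegree = 3 := by compute_degree!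
  obtain ⟨p, hp⟩ : ∃ p : ℤ[X], p = C c * X ^ 2 + C (b + 18 * c) * X + C (a + 9 * b + 81 * c) :=
    ⟨_, rfl⟩
  have hp0 : p = 0 := by
    by_contra hne
    have h1 := minpoly.isIntegrallyClosed_dvd hint (p := p)
      (by simp [hp, map_ofNat]; linear_combination h)
    have h2 := natDegree_le_of_dvd h1 hne
    rw [hmin, hd] at h2
    have h3 : p.natDegree ≤ 2 := by rw [hp]; compute_degree
    omega
  have h0 : p.coeff 0 = 0 := by simp [hp0]
  have h1 : p.coeff 1 = 0 := by simp [hp0]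
  have h2 : p.coeff 2 = 0 := by simp [hp0]
  simp only [hp, coeff_add, coeff_C_mul, coeff_X_pow, coeff_X, coeff_C] at h0 h1 h2
  norm_num at h0 h1 h2
  omega

theorem finrank_eq_three (hm : m ^ 3 - 8 * m ^ 2 + 15 * m - 7 = 0)
    (hgen : Algebra.adjoin ℚ {(m : M)} = ⊤) : Module.finrank ℚ M = 3 := by
  have hint : IsIntegral ℤ (m - 9) := RingOfIntegers.isIntegral _
  rw [← RingOfIntegers.rank, (PowerBasis.ofAdjoinEqTop' hint (adjoin_int_eq_top hm hgen)).finrank,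
    PowerBasis.ofAdjoinEqTop'_dim, (minpoly_sub_nine hm).1]
  compute_degree!

theorem exists_ringHom_real (hm : m ^ 3 - 8 * m ^ 2 + 15 * m - 7 = 0)
    (hgen : Algebra.adjoin ℚ {(m : M)} = ⊤) {r : ℝ} (hr : r ^ 3 - 8 * r ^ 2 + 15 * r - 7 = 0) :
    ∃ σ : 𝓞 M →+* ℝ, Function.Injective σ ∧ σ m = r := by
  let P := PowerBasis.ofAdjoinEqTop' (RingOfIntegers.isIntegral (m - 9))
    (adjoin_int_eq_top hm hgen)
  have hg : P.gen = m - 9 := by simp [P]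
  have hr' : aeval (r - 9) (minpoly ℤ P.gen) = 0 := by
    rw [hg, (minpoly_sub_nine hm).1]
    simp only [map_add, map_mul, map_pow, aeval_X, map_ofNat]; linear_combination hr
  have hval : P.lift (r - 9) hr' m = r := by
    have := P.lift_gen (r - 9) hr'
    rw [hg, map_sub, map_ofNat] at this
    linarith
  refine ⟨P.lift (r - 9) hr', ?_, hval⟩
  rw [RingHom.injective_iff_ker_eq_bot]
  refine Ideal.eq_bot_of_comap_eq_bot (R := ℤ) ?_
  rw [RingHom.comap_ker, ← RingHom.injective_iff_ker_eq_bot]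
  exact (RingHom.injective_int _)

theorem exists_real_roots : ∃ r : Fin 3 → ℝ, (∀ i, r i ^ 3 - 8 * r i ^ 2 + 15 * r i - 7 = 0) ∧
    (0 < r 0 ∧ r 0 < 1) ∧ (1 < r 1 ∧ r 1 < 2) ∧ 2 < r 2 := by
  have hc : Continuous fun x : ℝ => x ^ 3 - 8 * x ^ 2 + 15 * x - 7 := by fun_prop
  obtain ⟨r₀, h₀, h₀'⟩ := intermediate_value_Ioo (zero_le_one' ℝ) hc.continuousOn
    (show (0 : ℝ) ∈ Set.Ioo _ _ by norm_num)
  obtain ⟨r₁, h₁, h₁'⟩ := intermediate_value_Ioo' (one_le_two (α := ℝ)) hc.continuousOn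
    (show (0 : ℝ) ∈ Set.Ioo _ _ by norm_num)
  obtain ⟨r₂, h₂, h₂'⟩ := intermediate_value_Ioo (show (2 : ℝ) ≤ 6 by norm_num) hc.continuousOn
    (show (0 : ℝ) ∈ Set.Ioo _ _ by norm_num)
  refine ⟨![r₀, r₁, r₂], fun i => ?_, h₀, h₁, h₂.1⟩
  fin_cases i <;> assumption

/-- The three real embeddings of the cubic ring of integers, ordered by the image of `m`. -/
structure IsRealEmbeddings (m : 𝓞 M) (σ : Fin 3 → 𝓞 M →+* ℝ) : Prop where
  injective (i) : Function.Injective (σ i)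
  zero : 0 < σ 0 m ∧ σ 0 m < 1
  one : 1 < σ 1 m ∧ σ 1 m < 2
  two : 2 < σ 2 m
  prod_self : ∏ i, σ i m = 7
  prod_eq_int (x : 𝓞 M) : ∃ n : ℤ, ∏ i, σ i x = n

theorem exists_isRealEmbeddings (hm : m ^ 3 - 8 * m ^ 2 + 15 * m - 7 = 0)
    (hgen : Algebra.adjoin ℚ {(m : M)} = ⊤) :
    ∃ σ : Fin 3 → 𝓞 M →+* ℝ, IsRealEmbeddings m σ := by
  obtain ⟨r, hr, h₀, h₁, h₂⟩ := exists_real_roots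
  choose σ hinj hσ using fun i => exists_ringHom_real hm hgen (hr i)
  have h01 : r 0 - r 1 ≠ 0 := by linarith
  have h02 : r 0 - r 2 ≠ 0 := by linarith
  have h12 : r 1 - r 2 ≠ 0 := by linarith
  have q1 : r 0 ^ 2 + r 0 * r 1 + r 1 ^ 2 - 8 * (r 0 + r 1) + 15 = 0 :=
    mul_left_cancel₀ h01 (by linear_combination hr 0 - hr 1)
  have q2 : r 0 ^ 2 + r 0 * r 2 + r 2 ^ 2 - 8 * (r 0 + r 2) + 15 = 0 :=
    mul_left_cancel₀ h02 (by linear_combination hr 0 - hr 2)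
  have e1 : r 0 + r 1 + r 2 = 8 := mul_left_cancel₀ h12 (by linear_combination q1 - q2)
  have e2 : r 0 * r 1 + r 0 * r 2 + r 1 * r 2 = 15 := by
    linear_combination (r 0 + r 1) * e1 - q1
  have e3 : r 0 * r 1 * r 2 = 7 := by
    linear_combination hr 0 + r 0 * e2 - r 0 ^ 2 * e1
  refine ⟨σ, hinj, ?_, ?_, ?_, ?_, fun x => ?_⟩
  · rwa [hσ]
  · rwa [hσ]
  · rwa [hσ]
  · simpa [Fin.prod_univ_three, hσ] using e3
  · obtain ⟨a, b, c, rfl⟩ := exists_int_coords hm hgen x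
    refine ⟨a ^ 3 + 8 * a ^ 2 * b + 34 * a ^ 2 * c + 15 * a * b ^ 2 + 99 * a * b * c
      + 113 * a * c ^ 2 + 7 * b ^ 3 + 56 * b ^ 2 * c + 105 * b * c ^ 2 + 49 * c ^ 3, ?_⟩
    have key (s p q : ℝ) (hs : r 0 + r 1 + r 2 = s)
        (hp : r 0 * r 1 + r 0 * r 2 + r 1 * r 2 = p) (hq : r 0 * r 1 * r 2 = q) :
        (a + b * r 0 + c * r 0 ^ 2) * (a + b * r 1 + c * r 1 ^ 2) * (a + b * r 2 + c * r 2 ^ 2) =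
          (a ^ 3 + a ^ 2 * b * s + a ^ 2 * c * (s ^ 2 - 2 * p) + a * b ^ 2 * p
            + a * b * c * (s * p - 3 * q) + a * c ^ 2 * (p ^ 2 - 2 * s * q) + b ^ 3 * q
            + b ^ 2 * c * s * q + b * c ^ 2 * p * q + c ^ 3 * q ^ 2 : ℝ) := by
      subst hs hp hq; ring
    simp only [Fin.prod_univ_three, map_add, map_mul, map_pow, map_intCast, hσ]
    rw [key _ _ _ e1 e2 e3]
    push_cast
    ring

omit [NumberField M] in
theorem isUnit_sub_one (hm : m ^ 3 - 8 * m ^ 2 + 15 * m - 7 = 0) : IsUnit (m - 1) :=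
  IsUnit.of_mul_eq_one (-(m ^ 2 - 7 * m + 8)) (by linear_combination -hm)

omit [NumberField M] in
theorem isUnit_sub_two (hm : m ^ 3 - 8 * m ^ 2 + 15 * m - 7 = 0) : IsUnit (m - 2) :=
  IsUnit.of_mul_eq_one (m ^ 2 - 6 * m + 3) (by linear_combination hm)

namespace IsRealEmbeddings

variable {σ : Fin 3 → 𝓞 M →+* ℝ}

omit [NumberField M] in
theorem pos (h : IsRealEmbeddings m σ) (i : Fin 3) : 0 < σ i m := by
  have := h.zero; have := h.one; have := h.two
  fin_cases i <;> simp <;> linarith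

omit [NumberField M] in
theorem one_le_abs_prod (h : IsRealEmbeddings m σ) {x : 𝓞 M} (hx : x ≠ 0) :
    1 ≤ |∏ i, σ i x| := by
  obtain ⟨n, hn⟩ := h.prod_eq_int x
  have h0 : ∏ i, σ i x ≠ 0 :=
    Finset.prod_ne_zero_iff.2 fun i _ => (map_ne_zero_iff _ (h.injective i)).2 hx
  rw [hn] at h0 ⊢
  exact_mod_cast Int.one_le_abs (by exact_mod_cast h0)

omit [NumberField M] in
theorem abs_prod_eq_one (h : IsRealEmbeddings m σ) {x : 𝓞 M} (hx : IsUnit x) :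
    |∏ i, σ i x| = 1 := by
  obtain ⟨y, hy⟩ := hx.exists_right_inv
  have hxy : |∏ i, σ i x| * |∏ i, σ i y| = 1 := by
    simp [← abs_mul, ← Finset.prod_mul_distrib, ← map_mul, hy]
  have h1 := h.one_le_abs_prod (x := x) (by rintro rfl; simp at hy)
  have h2 := h.one_le_abs_prod (x := y) (by rintro rfl; simp at hy)
  nlinarith

omit [NumberField M] in
/-- A relation `x² + m z² = unit` forces `z = 0`. -/
theorem eq_zero_of_isUnit_sq_add (h : IsRealEmbeddings m σ) {x z : 𝓞 M}
    (hu : IsUnit (x ^ 2 + m * z ^ 2)) : z = 0 := by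
  by_contra hz
  have h1 := h.abs_prod_eq_one hu
  have h2 := h.one_le_abs_prod hz
  have h3 : ∏ i, (σ i m * σ i z ^ 2) ≤ ∏ i, σ i (x ^ 2 + m * z ^ 2) := by
    refine Finset.prod_le_prod (fun i _ => ?_) fun i _ => ?_
    · have := h.pos i; positivity
    · simp only [map_add, map_mul, map_pow]; nlinarith [sq_nonneg (σ i x)]
  rw [Finset.prod_mul_distrib, h.prod_self, Finset.prod_pow] at h3
  have h4 := le_abs_self (∏ i, σ i (x ^ 2 + m * z ^ 2))
  have h5 := sq_abs (∏ i, σ i z)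
  nlinarith

omit [NumberField M] in
/-- A unit `1 - 4 m t⁴` with `t ≠ 0` is not totally positive. -/
theorem eq_zero_of_totally_pos (h : IsRealEmbeddings m σ) {t : 𝓞 M}
    (hu : IsUnit (1 - 4 * m * t ^ 4)) (hpos : ∀ i, 0 < σ i (1 - 4 * m * t ^ 4)) : t = 0 := by
  by_contra ht
  have h1 := h.abs_prod_eq_one hu
  have hlt : ∀ i, σ i (1 - 4 * m * t ^ 4) < 1 := fun i => by
    have h0 : σ i t ≠ 0 := (map_ne_zero_iff _ (h.injective i)).2 ht
    have := h.pos i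
    have : 0 < 4 * σ i m * σ i t ^ 4 := by positivity
    simp only [map_sub, map_one, map_mul, map_ofNat, map_pow]; linarith
  have h2 : ∏ i, σ i (1 - 4 * m * t ^ 4) < ∏ _i : Fin 3, (1 : ℝ) :=
    Finset.prod_lt_prod_of_nonempty (fun i _ => hpos i) (fun i _ => hlt i) Finset.univ_nonempty
  rw [abs_of_pos (Finset.prod_pos fun i _ => hpos i)] at h1
  rw [h1] at h2
  simp at h2

end IsRealEmbeddings

/-- If the sign vectors of the units of a field of unit rank at most two with `±1` as torsion
exhaust all eight possibilities, then totally positive units are squares. -/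
theorem exists_sq_eq_of_pos (hrank : Units.rank M ≤ 2)
    (htor : ∀ x : Units.torsion M, (x : (𝓞 M)ˣ) = 1 ∨ (x : (𝓞 M)ˣ) = -1)
    {σ : Fin 3 → 𝓞 M →+* ℝ} (hsurj : ∀ s : Fin 3 → Prop, ∃ u : (𝓞 M)ˣ, ∀ i, 0 < σ i u ↔ s i)
    (u : (𝓞 M)ˣ) (hu : ∀ i, 0 < σ i u) : ∃ w : (𝓞 M)ˣ, u = w ^ 2 := by
  classical
  let φ : ℤˣ × (Fin (Units.rank M) → Fin 2) → (𝓞 M)ˣ :=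
    fun p => Units.map (Int.castRingHom (𝓞 M)).toMonoidHom p.1 *
      ∏ i, Units.fundSystem M i ^ (p.2 i : ℕ)
  have hφ (g : (𝓞 M)ˣ) : ∃ p w, g = φ p * w ^ 2 := by
    obtain ⟨⟨t, e⟩, hg, -⟩ := Units.exist_unique_eq_mul_prod M g
    have he (i) : ∃ (a : Fin 2) (k : ℤ), e i = (a : ℕ) + k * 2 := by
      refine ⟨⟨(e i % 2).toNat, by omega⟩, e i / 2, ?_⟩
      simp only
      omega
    choose a k hk using he
    obtain ⟨s, hs⟩ : ∃ s : ℤˣ, (t : (𝓞 M)ˣ) =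
        Units.map (Int.castRingHom (𝓞 M)).toMonoidHom s := by
      rcases htor t with h | h
      · exact ⟨1, by simp [h]⟩
      · exact ⟨-1, by ext; simp [h]⟩
    refine ⟨(s, a), ∏ i, Units.fundSystem M i ^ k i, ?_⟩
    simp only [φ, hg, ← hs, mul_assoc, ← Finset.prod_pow, ← Finset.prod_mul_distrib]
    congr 1
    refine Finset.prod_congr rfl fun i _ => ?_
    rw [hk, zpow_add, zpow_natCast, zpow_mul]
    norm_cast
  have hsq (i : Fin 3) (g w : (𝓞 M)ˣ) : 0 < σ i ((g * w ^ 2 : (𝓞 M)ˣ) : 𝓞 M) ↔ 0 < σ i g := by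
    have : 0 < σ i w ^ 2 := by
      have : σ i w ≠ 0 := (w.isUnit.map (σ i)).ne_zero
      positivity
    simp only [Units.val_mul, Units.val_pow_eq_pow_val, map_mul, map_pow]
    exact mul_pos_iff_of_pos_right this
  let ψ : ℤˣ × (Fin (Units.rank M) → Fin 2) → (Fin 3 → Prop) := fun p i => 0 < σ i (φ p)
  have hψ : Function.Surjective ψ := fun s => by
    obtain ⟨g, hg⟩ := hsurj s
    obtain ⟨p, w, rfl⟩ := hφ g
    exact ⟨p, funext fun i => propext ((hsq i _ w).symm.trans (hg i))⟩
  have hinj : Function.Injective ψ := by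
    refine (hψ.bijective_of_nat_card_le ?_).1
    have : 2 ^ Units.rank M ≤ 2 ^ 2 := Nat.pow_le_pow_right (by norm_num) hrank
    simp [Nat.card_eq_fintype_card]
    omega
  obtain ⟨p, w, rfl⟩ := hφ u
  have h1 : φ (1, 0) = 1 := by simp [φ]
  have hp : p = (1, 0) := hinj <| funext fun i => propext <| by
    simp only [ψ, h1, Units.val_one, map_one, zero_lt_one, iff_true]
    exact (hsq i _ w).1 (hu i)
  exact ⟨w, by rw [hp, h1, one_mul]⟩

theorem rank_le_two (hm : m ^ 3 - 8 * m ^ 2 + 15 * m - 7 = 0)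
    (hgen : Algebra.adjoin ℚ {(m : M)} = ⊤) : Units.rank M ≤ 2 := by
  have h1 := InfinitePlace.card_add_two_mul_card_eq_rank M
  have h2 := InfinitePlace.card_eq_nrRealPlaces_add_nrComplexPlaces M
  rw [finrank_eq_three hm hgen] at h1
  rw [Units.rank]
  omega

namespace IsRealEmbeddings

variable {σ : Fin 3 → 𝓞 M →+* ℝ}

omit [NumberField M] in
theorem exists_unit_signs (h : IsRealEmbeddings m σ)
    (s : Fin 3 → Prop) : ∃ (k i j : Fin 2), ∀ l,
      0 < σ l ((-1) ^ (k : ℕ) * (m - 1) ^ (i : ℕ) * (m - 2) ^ (j : ℕ)) ↔ s l := by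
  have h0 := h.zero
  have h1 := h.one
  have h2 := h.two
  classical
  refine ⟨if s 2 then 0 else 1, if s 0 ↔ s 1 then 0 else 1, if s 1 ↔ s 2 then 0 else 1, fun l => ?_⟩
  by_cases p0 : s 0 <;> by_cases p1 : s 1 <;> by_cases p2 : s 2 <;> fin_cases l <;>
    simp [p0, p1, p2, map_ofNat] <;> nlinarith

theorem exists_sign_mul_eq_sq (h : IsRealEmbeddings m σ) (hm : m ^ 3 - 8 * m ^ 2 + 15 * m - 7 = 0)
    (hgen : Algebra.adjoin ℚ {(m : M)} = ⊤) {e : 𝓞 M} (he : IsUnit e) :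
    ∃ (k i j : Fin 2) (w : 𝓞 M),
      (-1) ^ (k : ℕ) * (m - 1) ^ (i : ℕ) * (m - 2) ^ (j : ℕ) * w ^ 2 = e ∧
      ∀ l, 0 < σ l ((-1) ^ (k : ℕ) * (m - 1) ^ (i : ℕ) * (m - 2) ^ (j : ℕ)) ↔ 0 < σ l e := by
  have hunit (k i j : ℕ) : IsUnit ((-1) ^ k * (m - 1) ^ i * (m - 2) ^ j) :=
    ((isUnit_one.neg.pow k).mul ((isUnit_sub_one hm).pow i)).mul ((isUnit_sub_two hm).pow j)
  obtain ⟨k, i, j, hs⟩ := h.exists_unit_signs fun l => 0 < σ l e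
  obtain ⟨r, hr⟩ := hunit k i j
  obtain ⟨u, rfl⟩ := he
  rw [← hr] at hs
  have htor := Units.torsion_eq_one_or_neg_one_of_odd_finrank (K := M)
    (by rw [finrank_eq_three hm hgen]; decide)
  obtain ⟨w, hw⟩ := exists_sq_eq_of_pos (rank_le_two hm hgen) htor (σ := σ)
    (fun s => by
      obtain ⟨k, i, j, hs⟩ := h.exists_unit_signs s
      exact ⟨(hunit k i j).unit, hs⟩) (r * u) (fun l => by
      have h0 : σ l u ≠ 0 := (u.isUnit.map (σ l)).ne_zero
      have h1 : σ l r ≠ 0 := (r.isUnit.map (σ l)).ne_zero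
      rw [Units.val_mul, map_mul]
      rcases h0.lt_or_gt with h0 | h0
      · exact mul_pos_of_neg_of_neg (lt_of_le_of_ne (not_lt.1 ((hs l).not.2 h0.not_gt)) h1) h0
      · exact mul_pos ((hs l).2 h0) h0)
  refine ⟨k, i, j, ((w * r⁻¹ : (𝓞 M)ˣ) : 𝓞 M), ?_, by rwa [← hr]⟩
  rw [← hr, ← Units.val_pow_eq_pow_val, ← Units.val_mul, mul_pow, ← hw]
  congr 1
  calc r * (r * u * r⁻¹ ^ 2) = u * (r ^ 2 * (r ^ 2)⁻¹) := by rw [inv_pow, pow_two]; ac_rfl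
    _ = u := by rw [mul_inv_cancel, mul_one]

end IsRealEmbeddings

theorem zmod_coords_of_mul_sq_eq (hm : m ^ 3 - 8 * m ^ 2 + 15 * m - 7 = 0)
    (hgen : Algebra.adjoin ℚ {(m : M)} = ⊤) (r₀ r₁ r₂ : ℤ) {w y : 𝓞 M}
    (h : (r₀ + r₁ * m + r₂ * m ^ 2) * w ^ 2 = 1 - 4 * y) :
    ∃ a b c : ZMod 4,
      r₀ * (a ^ 2 + 2 * b * c) - r₁ * (b ^ 2 + 2 * a * c + c ^ 2)
        - r₂ * (2 * a * b + 2 * b * c - c ^ 2) = 1 ∧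
      r₀ * (2 * a * b + 2 * b * c - c ^ 2) + r₁ * (a ^ 2 + 2 * b * c)
        + r₁ * (b ^ 2 + 2 * a * c + c ^ 2) + r₂ * (2 * a * b + 2 * b * c - c ^ 2)
        - r₂ * (b ^ 2 + 2 * a * c + c ^ 2) = 0 ∧
      r₀ * (b ^ 2 + 2 * a * c + c ^ 2) + r₁ * (2 * a * b + 2 * b * c - c ^ 2)
        + r₂ * (a ^ 2 + 2 * b * c) + r₂ * (b ^ 2 + 2 * a * c + c ^ 2) = 0 := by
  obtain ⟨a, b, c, rfl⟩ := exists_int_coords hm hgen w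
  obtain ⟨p, q, r, rfl⟩ := exists_int_coords hm hgen y
  obtain ⟨A, hA⟩ : ∃ A, A = a ^ 2 + 14 * b * c + 56 * c ^ 2 := ⟨_, rfl⟩
  obtain ⟨B, hB⟩ : ∃ B, B = 2 * a * b - 30 * b * c - 113 * c ^ 2 := ⟨_, rfl⟩
  obtain ⟨C, hC⟩ : ∃ C, C = b ^ 2 + 2 * a * c + 16 * b * c + 49 * c ^ 2 := ⟨_, rfl⟩
  have hsq : (a + b * m + c * m ^ 2) ^ 2 = A + B * m + C * m ^ 2 := by
    rw [hA, hB, hC]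
    push_cast
    linear_combination (2 * b * c + c ^ 2 * (m + 8)) * hm
  rw [hsq] at h
  obtain ⟨h0, h1, h2⟩ := int_coords_eq_zero hm
    (a := r₀ * A + 7 * (r₁ * C + r₂ * B) + 56 * r₂ * C - 1 + 4 * p)
    (b := r₀ * B + r₁ * A - 15 * (r₁ * C + r₂ * B) - 113 * r₂ * C + 4 * q)
    (c := r₀ * C + r₁ * B + r₂ * A + 8 * (r₁ * C + r₂ * B) + 49 * r₂ * C + 4 * r) (by
      push_cast
      linear_combination h - (r₁ * C + r₂ * B + r₂ * C * (m + 8)) * hm)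
  have h4 : (4 : ZMod 4) = 0 := rfl
  replace h0 := congrArg (Int.cast : ℤ → ZMod 4) h0
  replace h1 := congrArg (Int.cast : ℤ → ZMod 4) h1
  replace h2 := congrArg (Int.cast : ℤ → ZMod 4) h2
  subst hA hB hC
  push_cast at h0 h1 h2
  refine ⟨a, b, c, ?_, ?_, ?_⟩
  · linear_combination h0 +
      (-3 * r₀ * b * c - 14 * r₀ * c ^ 2 - 4 * a * b * r₂ - 4 * a * c * r₁ - 28 * a *
      c * r₂ - 28 * b * c * r₁ - 172 * b * c * r₂ - 2 * b ^ 2 * r₁ - 14 * b ^ 2 * r₂ -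
      86 * c ^ 2 * r₁ - 488 * c ^ 2 * r₂ - p) * h4
  · linear_combination h1 +
      (8 * r₀ * b * c + 28 * r₀ * c ^ 2 + 8 * a * b * r₂ + 8 * a * c * r₁ + 56 * a * c
      * r₂ + 57 * b * c * r₁ + 340 * b * c * r₂ + 4 * b ^ 2 * r₁ + 28 * b ^ 2 * r₂ +
      170 * c ^ 2 * r₁ + 960 * c ^ 2 * r₂ - q) * h4
  · linear_combination h2 +
      (-4 * r₀ * b * c - 12 * r₀ * c ^ 2 - 4 * a * b * r₂ - 24 * b * c * r₁ - 139 * b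
      * c * r₂ - 2 * b ^ 2 * r₁ - 12 * b ^ 2 * r₂ - 4 * a * c * r₁ - 24 * a * c * r₂ -
      70 * c ^ 2 * r₁ - 388 * c ^ 2 * r₂ - r) * h4

/-- If `1 - 4 m t⁴` is a unit, then `t = 0`. -/
theorem IsRealEmbeddings.eq_zero_of_isUnit {σ : Fin 3 → 𝓞 M →+* ℝ} (h : IsRealEmbeddings m σ)
    (hm : m ^ 3 - 8 * m ^ 2 + 15 * m - 7 = 0)
    (hgen : Algebra.adjoin ℚ {(m : M)} = ⊤) {t : 𝓞 M} (hu : IsUnit (1 - 4 * m * t ^ 4)) :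
    t = 0 := by
  obtain ⟨k, i, j, w, hw, hs⟩ := h.exists_sign_mul_eq_sq hm hgen hu
  have key (r₀ r₁ r₂ : ℤ) (hr : (r₀ + r₁ * m + r₂ * m ^ 2 : 𝓞 M) =
      (-1) ^ (k : ℕ) * (m - 1) ^ (i : ℕ) * (m - 2) ^ (j : ℕ)) :=
    zmod_coords_of_mul_sq_eq hm hgen r₀ r₁ r₂ (w := w) (y := m * t ^ 4)
      (by rw [hr, hw]; ring)
  suffices k = 0 ∧ i = 0 ∧ j = 0 by
    obtain ⟨rfl, rfl, rfl⟩ := this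
    exact h.eq_zero_of_totally_pos hu fun l => (hs l).1 (by simp)
  fin_cases k <;> fin_cases i <;> fin_cases j <;> simp at key ⊢
  · obtain ⟨a, b, c, H⟩ := key (-2) 1 0 (by push_cast; ring)
    revert a b c; decide
  · obtain ⟨a, b, c, H⟩ := key (-1) 1 0 (by push_cast; ring)
    revert a b c; decide
  · obtain ⟨a, b, c, H⟩ := key 2 (-3) 1 (by push_cast; ring)
    revert a b c; decide
  · obtain ⟨a, b, c, H⟩ := key (-1) 0 0 (by push_cast; ring)
    revert a b c; decide
  · obtain ⟨a, b, c, H⟩ := key 2 (-1) 0 (by push_cast; ring)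
    revert a b c; decide
  · obtain ⟨a, b, c, H⟩ := key 1 (-1) 0 (by push_cast; ring)
    revert a b c; decide
  · obtain ⟨a, b, c, H⟩ := key (-2) 3 (-1) (by push_cast; ring)
    revert a b c; decide

/-- The factored index form of `𝓞 M[⁴√(-m)]` takes unit values only at `(x, 0, 0)` with `x` a
unit. -/
theorem index_form_solution (hm : m ^ 3 - 8 * m ^ 2 + 15 * m - 7 = 0)
    (hgen : Algebra.adjoin ℚ {(m : M)} = ⊤) {x y z : 𝓞 M}
    (h : IsUnit ((x ^ 2 + m * z ^ 2) * ((x ^ 2 + m * z ^ 2) ^ 2 - 4 * m * (y ^ 2 - x * z) ^ 2))) :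
    IsUnit x ∧ y = 0 ∧ z = 0 := by
  obtain ⟨σ, hσ⟩ := exists_isRealEmbeddings hm hgen
  obtain ⟨h1, h2⟩ := IsUnit.mul_iff.1 h
  obtain rfl := hσ.eq_zero_of_isUnit_sq_add h1
  have hx : IsUnit x := isUnit_pow_iff two_ne_zero |>.1 (by simpa using h1)
  obtain ⟨x', hx'⟩ := hx.exists_right_inv
  have hx'u : IsUnit x' := IsUnit.of_mul_eq_one x (by rw [mul_comm, hx'])
  have h3 : IsUnit (1 - 4 * m * (y * x') ^ 4) := by
    have := h2.mul (hx'u.pow 4)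
    convert this using 1
    linear_combination (-(1 + x * x') * (1 + x ^ 2 * x' ^ 2)) * hx'
  refine ⟨hx, ?_, rfl⟩
  have := hσ.eq_zero_of_isUnit hm hgen h3
  exact (mul_eq_zero.1 this).resolve_right hx'u.ne_zero

theorem zmod_two_eq_zero_or_eq_zero : ∀ a b c d e f : ZMod 2, a * d + (b * f + c * e) = 0 ∧
    a * e + b * d + (b * f + c * e) + c * f = 0 ∧ a * f + b * e + c * d + c * f = 0 →
    (a = 0 ∧ b = 0 ∧ c = 0) ∨ (d = 0 ∧ e = 0 ∧ f = 0) := by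
  decide

theorem prime_two (hm : m ^ 3 - 8 * m ^ 2 + 15 * m - 7 = 0)
    (hgen : Algebra.adjoin ℚ {(m : M)} = ⊤) : Prime (2 : 𝓞 M) := by
  refine ⟨two_ne_zero, fun h => ?_, fun u v ⟨w, hw⟩ => ?_⟩
  · obtain ⟨w, hw⟩ := h.exists_right_inv
    obtain ⟨a, b, c, rfl⟩ := exists_int_coords hm hgen w
    have := (int_coords_eq_zero hm (a := 2 * a - 1) (b := 2 * b) (c := 2 * c) (by
      push_cast; linear_combination hw)).1
    omega
  · obtain ⟨a, b, c, rfl⟩ := exists_int_coords hm hgen u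
    obtain ⟨d, e, f, rfl⟩ := exists_int_coords hm hgen v
    obtain ⟨p, q, r, rfl⟩ := exists_int_coords hm hgen w
    obtain ⟨h0, h1, h2⟩ := int_coords_eq_zero hm
      (a := a * d + 7 * (b * f + c * e) + 56 * (c * f) - 2 * p)
      (b := a * e + b * d - 15 * (b * f + c * e) - 113 * (c * f) - 2 * q)
      (c := a * f + b * e + c * d + 8 * (b * f + c * e) + 49 * (c * f) - 2 * r) (by
        push_cast
        linear_combination hw - (b * f + c * e + c * f * (m + 8)) * hm)
    have dvd {a b c : ℤ} (h : (a : ZMod 2) = 0 ∧ (b : ZMod 2) = 0 ∧ (c : ZMod 2) = 0) :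
        (2 : 𝓞 M) ∣ a + b * m + c * m ^ 2 := by
      simp only [ZMod.intCast_zmod_eq_zero_iff_dvd] at h
      obtain ⟨⟨a, rfl⟩, ⟨b, rfl⟩, ⟨c, rfl⟩⟩ := h
      exact ⟨a + b * m + c * m ^ 2, by push_cast; ring⟩
    have two : (2 : ZMod 2) = 0 := rfl
    replace h0 := congrArg (Int.cast : ℤ → ZMod 2) h0
    replace h1 := congrArg (Int.cast : ℤ → ZMod 2) h1
    replace h2 := congrArg (Int.cast : ℤ → ZMod 2) h2
    push_cast at h0 h1 h2
    refine (zmod_two_eq_zero_or_eq_zero a b c d e f ⟨?_, ?_, ?_⟩).imp dvd dvd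
    · linear_combination h0 - (3 * (b * f + c * e) + 28 * (c * f) - p) * two
    · linear_combination h1 + (8 * (b * f + c * e) + 57 * (c * f) + q) * two
    · linear_combination h2 - (4 * (b * f + c * e) + 24 * (c * f) - r) * two

theorem prime_of_cubic (hm : m ^ 3 - 8 * m ^ 2 + 15 * m - 7 = 0)
    (hgen : Algebra.adjoin ℚ {(m : M)} = ⊤) : Prime m := by
  refine ⟨?_, fun h => ?_, fun u v ⟨w, hw⟩ => ?_⟩
  · rintro rfl
    norm_num at hm
  · obtain ⟨w, hw⟩ := h.exists_right_inv
    obtain ⟨a, b, c, rfl⟩ := exists_int_coords hm hgen w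
    have := (int_coords_eq_zero hm (a := 7 * c - 1) (b := a - 15 * c) (c := b + 8 * c) (by
      push_cast; linear_combination hw - c * hm)).1
    omega
  · obtain ⟨a, b, c, rfl⟩ := exists_int_coords hm hgen u
    obtain ⟨d, e, f, rfl⟩ := exists_int_coords hm hgen v
    obtain ⟨p, q, r, rfl⟩ := exists_int_coords hm hgen w
    have h0 := (int_coords_eq_zero hm
      (a := a * d + 7 * (b * f + c * e) + 56 * (c * f) - 7 * r)
      (b := a * e + b * d - 15 * (b * f + c * e) - 113 * (c * f) - p + 15 * r)
      (c := a * f + b * e + c * d + 8 * (b * f + c * e) + 49 * (c * f) - q - 8 * r) (by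
        push_cast
        linear_combination hw - (b * f + c * e + c * f * (m + 8) - r) * hm)).1
    have dvd {a b c : ℤ} (h : 7 ∣ a) : m ∣ a + b * m + c * m ^ 2 := by
      obtain ⟨a, rfl⟩ := h
      exact ⟨a * (m ^ 2 - 8 * m + 15) + b + c * m, by push_cast; linear_combination (-a : 𝓞 M) * hm⟩
    have h7 : (7 : ℤ) ∣ a * d := ⟨r - (b * f + c * e) - 8 * (c * f), by linear_combination h0⟩
    exact ((show Prime (7 : ℤ) by norm_num).dvd_or_dvd h7).imp dvd dvd

theorem not_four_dvd (hm : m ^ 3 - 8 * m ^ 2 + 15 * m - 7 = 0)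
    (hgen : Algebra.adjoin ℚ {(m : M)} = ⊤) : ¬ (2 : 𝓞 M) ^ 2 ∣ (m ^ 2) ^ 4 + m := by
  rintro ⟨w, hw⟩
  obtain ⟨a, b, c, rfl⟩ := exists_int_coords hm hgen w
  have := (int_coords_eq_zero hm (a := 60074 - 4 * a) (b := -117858 - 4 * b)
    (c := 47314 - 4 * c) (by
      push_cast
      linear_combination hw -
        (8582 + 1553 * m + 279 * m ^ 2 + 49 * m ^ 3 + 8 * m ^ 4 + m ^ 5) * hm)).1
  omega

section PureQuartic

variable {K : Type*} [Field K] [NumberField K] [Algebra M K] {x : 𝓞 K}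

omit [NumberField K] in
theorem minpoly_eq_X_pow_four_add_C (hm : m ^ 3 - 8 * m ^ 2 + 15 * m - 7 = 0)
    (hgen : Algebra.adjoin ℚ {(m : M)} = ⊤) (hx : x ^ 4 = -algebraMap (𝓞 M) (𝓞 K) m) :
    minpoly (𝓞 M) x = X ^ 4 + C m ∧ (minpoly (𝓞 M) x).IsEisensteinAt (Ideal.span {m}) := by
  have hp := prime_of_cubic hm hgen
  have hf : (X ^ 4 + C m : (𝓞 M)[X]).Monic := monic_X_pow_add_C m (by norm_num)
  have hd : (X ^ 4 + C m : (𝓞 M)[X]).natDegree = 4 := by compute_degree!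
  have hei : (X ^ 4 + C m : (𝓞 M)[X]).IsEisensteinAt (Ideal.span {m}) := by
    refine isEisensteinAt_of_monic_of_dvd hp hf (fun n hn => ?_) ?_
    · rw [hd] at hn
      interval_cases n <;> simp [coeff_X_pow, coeff_C]
    · simp only [coeff_add, coeff_X_pow, coeff_C]
      rintro ⟨w, hw⟩
      refine hp.not_isUnit (IsUnit.of_mul_eq_one w (mul_left_cancel₀ hp.ne_zero ?_))
      norm_num at hw
      linear_combination -hw
  have h := minpoly_eq_of_isEisensteinAt hp hf (by rw [hd]; norm_num) hei (x := x) (by simp [hx])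
  exact ⟨h, h ▸ hei⟩

omit [NumberField K] in
theorem isEisensteinAt_two_minpoly_sub (hm : m ^ 3 - 8 * m ^ 2 + 15 * m - 7 = 0)
    (hgen : Algebra.adjoin ℚ {(m : M)} = ⊤) (hx : x ^ 4 = -algebraMap (𝓞 M) (𝓞 K) m) :
    (minpoly (𝓞 M) (x - algebraMap (𝓞 M) (𝓞 K) (m ^ 2))).IsEisensteinAt (Ideal.span {2}) := by
  obtain ⟨c, hc⟩ : ∃ c, c = m ^ 2 := ⟨_, rfl⟩
  have hp := prime_two hm hgen
  have h4 := not_four_dvd hm hgen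
  have h2 : 2 ∣ c ^ 4 + m := ⟨30037 - 58929 * m + 23657 * m ^ 2, by
    rw [hc]
    linear_combination
      (8582 + 1553 * m + 279 * m ^ 2 + 49 * m ^ 3 + 8 * m ^ 4 + m ^ 5) * hm⟩
  rw [← hc] at h4 ⊢
  obtain ⟨f, hfdef⟩ : ∃ f : (𝓞 M)[X], f = X ^ 4 + C (2 * (2 * c)) * X ^ 3 +
    C (2 * (3 * c ^ 2)) * X ^ 2 + C (2 * (2 * c ^ 3)) * X + C (c ^ 4 + m) := ⟨_, rfl⟩
  have hf : f.Monic := by rw [hfdef]; monicity!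
  have hd : f.natDegree = 4 := by rw [hfdef]; compute_degree!
  have hei : f.IsEisensteinAt (Ideal.span {2}) := by
    refine isEisensteinAt_of_monic_of_dvd hp hf (fun n hn => ?_) ?_
    · rw [hd] at hn
      interval_cases n <;>
        simp only [hfdef, coeff_add, coeff_C_mul, coeff_X_pow, coeff_X, coeff_C] <;>
        norm_num [h2, mul_assoc]
    · simpa only [hfdef, coeff_add, coeff_C_mul, coeff_X_pow, coeff_X, coeff_C, OfNat.zero_ne_ofNat,
        one_ne_zero, if_false, if_true, mul_zero, zero_add] using h4
  rw [minpoly_eq_of_isEisensteinAt hp hf (by rw [hd]; norm_num) hei]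
  · exact hei
  · simp only [hfdef, map_add, map_mul, map_pow, aeval_X, aeval_C, map_ofNat]
    linear_combination hx

theorem adjoin_ringOfIntegers_eq_top (hm : m ^ 3 - 8 * m ^ 2 + 15 * m - 7 = 0)
    (hgen : Algebra.adjoin ℚ {(m : M)} = ⊤) (hx : x ^ 4 = -algebraMap (𝓞 M) (𝓞 K) m)
    (hK : Algebra.adjoin M {(x : K)} = ⊤) : Algebra.adjoin (𝓞 M) {x} = ⊤ := by
  obtain ⟨hmin, hei⟩ := minpoly_eq_X_pow_four_add_C hm hgen hx
  have hei2 := isEisensteinAt_two_minpoly_sub hm hgen hx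
  have hK' : Algebra.adjoin M {algebraMap (𝓞 K) K (x - algebraMap (𝓞 M) (𝓞 K) (m ^ 2))} = ⊤ := by
    rw [← hK, ← adjoin_sub_algebraMap (x : K) ((m : M) ^ 2)]
    congr 2
  refine Algebra.eq_top_iff.2 fun y => ?_
  refine mem_adjoin_of_prime_pow_mul_mem M K (n := 1) (prime_of_cubic hm hgen) hK hei ?_
  have hadj := adjoin_sub_algebraMap x (m ^ 2)
  rw [← hadj]
  refine mem_adjoin_of_prime_pow_mul_mem M K (n := 2) (prime_two hm hgen) hK' hei2 ?_
  rw [hadj]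
  have hy := aeval_derivative_minpoly_mul_mem_adjoin M K (A := 𝓞 M) hK y
  have key : algebraMap (𝓞 M) (𝓞 K) 2 ^ 2 * (algebraMap (𝓞 M) (𝓞 K) m ^ 1 * y) =
      -x * (aeval x (derivative (minpoly (𝓞 M) x)) * y) := by
    rw [hmin]
    simp only [derivative_X_pow, derivative_C, map_add, map_mul, map_pow, aeval_X,
      map_zero, Nat.cast_ofNat, map_ofNat]
    linear_combination (4 * y) * hx
  rw [key]
  exact mul_mem (neg_mem (Algebra.self_mem_adjoin_singleton _ x)) hy

omit [NumberField K] in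
/-- The index form of a relative power integral basis generator is a unit. -/
theorem isUnit_indexForm (hm : m ^ 3 - 8 * m ^ 2 + 15 * m - 7 = 0)
    (hgen : Algebra.adjoin ℚ {(m : M)} = ⊤) (hx : x ^ 4 = -algebraMap (𝓞 M) (𝓞 K) m)
    (htop : Algebra.adjoin (𝓞 M) {x} = ⊤) {b c d : 𝓞 M} {ζ : 𝓞 K}
    (hζ : ζ = algebraMap (𝓞 M) (𝓞 K) b * x + algebraMap (𝓞 M) (𝓞 K) c * x ^ 2 +
      algebraMap (𝓞 M) (𝓞 K) d * x ^ 3)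
    (hζtop : Algebra.adjoin (𝓞 M) {ζ} = ⊤) :
    IsUnit ((b ^ 2 + m * d ^ 2) *
      ((b ^ 2 + m * d ^ 2) ^ 2 - 4 * m * (c ^ 2 - b * d) ^ 2)) := by
  have hint (y : 𝓞 K) : IsIntegral (𝓞 M) y := Algebra.IsIntegral.isIntegral y
  have hrank : Module.finrank (𝓞 M) (𝓞 K) = 4 := by
    rw [(PowerBasis.ofAdjoinEqTop' (hint x) htop).finrank, PowerBasis.ofAdjoinEqTop'_dim,
      (minpoly_eq_X_pow_four_add_C hm hgen hx).1]
    compute_degree!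
  obtain ⟨e, he⟩ := exists_basis_pow_of_adjoin_eq_top (hint x) htop hrank
  obtain ⟨e', he'⟩ := exists_basis_pow_of_adjoin_eq_top (hint ζ) hζtop hrank
  have hdet := e.isUnit_det e'
  obtain ⟨p₀, hp₀⟩ : ∃ p, p = -(c ^ 2 + 2 * b * d) * m := ⟨_, rfl⟩
  obtain ⟨p₁, hp₁⟩ : ∃ p, p = -(2 * c * d) * m := ⟨_, rfl⟩
  obtain ⟨p₂, hp₂⟩ : ∃ p, p = b ^ 2 - d ^ 2 * m := ⟨_, rfl⟩
  obtain ⟨p₃, hp₃⟩ : ∃ p, p = 2 * b * c := ⟨_, rfl⟩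
  let N : Matrix (Fin 4) (Fin 4) (𝓞 M) :=
    !![1, 0, p₀, -m * (b * p₃ + c * p₂ + d * p₁);
       0, b, p₁, b * p₀ - m * (c * p₃ + d * p₂);
       0, c, p₂, b * p₁ + c * p₀ - m * d * p₃;
       0, d, p₃, b * p₂ + c * p₁ + d * p₀]
  have hN : e.toMatrix e' = N := by
    have hsum (j : Fin 4) : e' j = ∑ i, N i j • e i := by
      have h2 : ζ ^ 2 = algebraMap (𝓞 M) (𝓞 K) p₀ + algebraMap (𝓞 M) (𝓞 K) p₁ * x +
          algebraMap (𝓞 M) (𝓞 K) p₂ * x ^ 2 + algebraMap (𝓞 M) (𝓞 K) p₃ * x ^ 3 := by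
        simp only [hζ, hp₀, hp₁, hp₂, hp₃, map_neg, map_add, map_sub, map_mul, map_pow, map_ofNat]
        linear_combination (norm := (simp only [map_add, map_mul, map_pow, map_ofNat]; ring1))
          (algebraMap (𝓞 M) (𝓞 K) (c ^ 2 + 2 * b * d) +
          algebraMap (𝓞 M) (𝓞 K) (2 * c * d) * x + algebraMap (𝓞 M) (𝓞 K) d ^ 2 * x ^ 2) * hx
      simp only [he', he, Fin.sum_univ_four, Algebra.smul_def]
      fin_cases j
      · simp [N]
      · simp [N, hζ]
      · simp [N, h2]
      · simp [N]
        rw [pow_succ, h2, hζ]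
        linear_combination (norm := (simp only [map_add, map_mul]; ring1))
          (algebraMap (𝓞 M) (𝓞 K) (b * p₃ + c * p₂ + d * p₁) +
          algebraMap (𝓞 M) (𝓞 K) (c * p₃ + d * p₂) * x +
          algebraMap (𝓞 M) (𝓞 K) (d * p₃) * x ^ 2) * hx
    ext i j
    rw [Module.Basis.toMatrix_apply, hsum]
    simp [Finsupp.single_apply]
  rw [Module.Basis.det_apply, hN] at hdet
  convert hdet using 1
  simp [N, Matrix.det_succ_row_zero, Fin.sum_univ_succ, Fin.succAbove, hp₀, hp₁, hp₂, hp₃]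
  ring

theorem exists_eq_add_unit_mul (hm : m ^ 3 - 8 * m ^ 2 + 15 * m - 7 = 0)
    (hgen : Algebra.adjoin ℚ {(m : M)} = ⊤) (hx : x ^ 4 = -algebraMap (𝓞 M) (𝓞 K) m)
    (hK : Algebra.adjoin M {(x : K)} = ⊤) {ζ : 𝓞 K} (hζ : Algebra.adjoin (𝓞 M) {ζ} = ⊤) :
    ∃ (z₀ z₁ z₂ : ℤ) (ε : (𝓞 M)ˣ), ζ = z₀ + z₁ * algebraMap (𝓞 M) (𝓞 K) m +
      z₂ * algebraMap (𝓞 M) (𝓞 K) m ^ 2 + algebraMap (𝓞 M) (𝓞 K) ε * x := by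
  have htop := adjoin_ringOfIntegers_eq_top hm hgen hx hK
  have hf : (X ^ 4 + C m : (𝓞 M)[X]).Monic := monic_X_pow_add_C m (by norm_num)
  have hd : (X ^ 4 + C m : (𝓞 M)[X]).natDegree = 4 := by compute_degree!
  obtain ⟨a, ha⟩ := exists_eq_sum_of_mem_adjoin hf (x := x) (by simp [hx])
    (y := ζ) (htop ▸ Algebra.mem_top) hd
  obtain ⟨a, b, c, d, rfl⟩ : ∃ a b c d : 𝓞 M, ζ = algebraMap (𝓞 M) (𝓞 K) a +
      (algebraMap (𝓞 M) (𝓞 K) b * x + algebraMap (𝓞 M) (𝓞 K) c * x ^ 2 +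
        algebraMap (𝓞 M) (𝓞 K) d * x ^ 3) :=
    ⟨a 0, a 1, a 2, a 3, by rw [ha, Fin.sum_univ_four]; simp; ring⟩
  have hsub := adjoin_sub_algebraMap (algebraMap (𝓞 M) (𝓞 K) a +
      (algebraMap (𝓞 M) (𝓞 K) b * x + algebraMap (𝓞 M) (𝓞 K) c * x ^ 2 +
        algebraMap (𝓞 M) (𝓞 K) d * x ^ 3)) a
  rw [add_sub_cancel_left, hζ] at hsub
  obtain ⟨⟨ε, rfl⟩, rfl, rfl⟩ := index_form_solution hm hgen
    (isUnit_indexForm hm hgen hx htop rfl hsub)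
  obtain ⟨z₀, z₁, z₂, rfl⟩ := exists_int_coords hm hgen a
  exact ⟨z₀, z₁, z₂, ε, by simp⟩

end PureQuartic

end CubicField

end

/-- Let `K = ℚ(ξ)` with `ξ` a root of `f₁₂(x) = x¹² + 8x⁸ + 15x⁴ + 7`, `μ = −ξ⁴`, and
`M = ℚ(μ)`.  If `ζ ∈ 𝓞 K` satisfies `ℤ[ζ] = 𝓞 K` (i.e. `ζ` generates a power integral basis
of `K`), then `ζ = z₀ + z₁μ + z₂μ² + ε ξ` with rational integers `z₀, z₁, z₂` and a unit `ε`
of `𝓞 M`. -/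
theorem generators_of_power_integral_bases_of_f12
    (K M : Type*) [Field K] [NumberField K] [Field M] [NumberField M] [Algebra M K]
    (ξ : K) (hroot : ξ ^ 12 + 8 * ξ ^ 8 + 15 * ξ ^ 4 + 7 = 0)
    (hKgen : Algebra.adjoin ℚ {ξ} = ⊤)
    (μ : M) (hμ : algebraMap M K μ = -ξ ^ 4)
    (hMgen : Algebra.adjoin ℚ {μ} = ⊤)
    (ζ : 𝓞 K)
    (hζ : Algebra.adjoin ℤ {ζ} = ⊤) :
    ∃ (z₀ z₁ z₂ : ℤ) (ε : (𝓞 M)ˣ),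
      algebraMap (𝓞 K) K ζ =
        (z₀ : K) + (z₁ : K) * algebraMap M K μ + (z₂ : K) * algebraMap M K μ ^ 2
          + algebraMap M K (algebraMap (𝓞 M) M (ε : 𝓞 M)) * ξ := by
  have hcubic : μ ^ 3 - 8 * μ ^ 2 + 15 * μ - 7 = 0 := by
    refine (algebraMap M K).injective ?_
    simp only [map_sub, map_add, map_mul, map_pow, map_ofNat, map_zero, hμ]
    linear_combination -hroot
  have hμint := isIntegral_int_of_cubic hcubic
  have hξint : IsIntegral ℤ ξ := .of_pow (n := 4) (by norm_num) (by
    rw [← neg_eq_iff_eq_neg.2 hμ]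
    exact (hμint.map (IsScalarTower.toAlgHom ℤ M K)).neg)
  obtain ⟨m, rfl⟩ : ∃ m : 𝓞 M, (m : M) = μ := ⟨⟨μ, hμint⟩, rfl⟩
  obtain ⟨x, rfl⟩ : ∃ x : 𝓞 K, (x : K) = ξ := ⟨⟨ξ, hξint⟩, rfl⟩
  have hm : m ^ 3 - 8 * m ^ 2 + 15 * m - 7 = 0 := RingOfIntegers.coe_injective (by
    simpa [map_ofNat] using hcubic)
  have hx : x ^ 4 = -algebraMap (𝓞 M) (𝓞 K) m := RingOfIntegers.coe_injective (by
    rw [map_pow, map_neg, ← IsScalarTower.algebraMap_apply,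
      IsScalarTower.algebraMap_apply (𝓞 M) M K, hμ, neg_neg])
  obtain ⟨z₀, z₁, z₂, ε, rfl⟩ := exists_eq_add_unit_mul hm hMgen hx
    (adjoin_eq_top_of_tower M hKgen) (adjoin_eq_top_of_tower (𝓞 M) hζ)
  exact ⟨z₀, z₁, z₂, ε, by
    simp [← IsScalarTower.algebraMap_apply]⟩
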